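/- Let α ≥ 1 and N ≥ 2, let ψ : ℝ^N → ℂ be smooth, symmetric, normalized (∫|ψ|² = 1), vanishing on a neighborhood of the diagonal set {x : x_j = x_k for some j ≠ k}, and with one-particle density ρ(x) := N·∫|ψ(x, x_2,…,x_N)|² dx_2⋯dx_N. Let Q₀ ⊂ ℝ be a finite interval with ∫_{Q₀} ρ ≥ 2, and define the local Calogero–Sutherland kinetic energy T_H^{Q₀} := ∑_{j=1}^N ∫_{ℝ^N} (1/2)·( |∂_j ψ|² + ∑_{k≠j} α(α−1)·|ψ|²/(x_j − x_k)² )·χ_{Q₀}(x_j) dx. Then T_H^{Q₀} ≥ (1/32)·(π²/4 + α(α−1))·(∫_{Q₀} ρ dx)³ / |Q₀|². In particular, if ρ is supported on an interval of length L then the total kinetic energy satisfies T_H ≥ (1/32)·(π²/4 + α(α−1))·N³/L². -/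

import Mathlib

open MeasureTheory

/-- `∫ |ψ|²` over all particle coordinates except the `j`-th one, which is set to `y`. -/
noncomputable def densityAt {N : ℕ} (ψ : (Fin N → ℝ) → ℂ) (j : Fin N) (y : ℝ) : ℝ :=
  ∫ z : {k : Fin N // k ≠ j} → ℝ,
    ‖ψ (fun k => if h : k = j then y else z ⟨k, h⟩)‖ ^ 2

section PairSums
variable {ι : Type*} [DecidableEq ι]

theorem sum_erase_div_sub (S : Finset ι) (u : ι → ℝ) (hu : Set.InjOn u S) (c : ℝ) :
    ∑ j ∈ S, (u j - c) * ∑ k ∈ S.erase j, (u j - u k)⁻¹ = (S.card : ℝ) * (S.card - 1) / 2 := by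
  induction S using Finset.induction_on with
  | empty => simp
  | insert i S hi ih =>
    have hne : ∀ j ∈ S, u i - u j ≠ 0 := fun j hj h => hi (by
      rwa [hu (Finset.mem_insert_self i S) (Finset.mem_insert_of_mem hj) (sub_eq_zero.1 h)])
    have hstep : ∀ j ∈ S, (u j - c) * ∑ k ∈ (insert i S).erase j, (u j - u k)⁻¹
        = (u j - c) * ∑ k ∈ S.erase j, (u j - u k)⁻¹ + (u j - c) * (u j - u i)⁻¹ := by
      intro j hj
      have hij : i ≠ j := by rintro rfl; exact hi hj
      rw [Finset.erase_insert_of_ne hij, Finset.sum_insert (by simp [hi])]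
      ring
    rw [Finset.sum_insert hi, Finset.erase_insert hi, Finset.sum_congr rfl hstep,
      Finset.sum_add_distrib, ih (hu.mono (by simp)), Finset.card_insert_of_notMem hi,
      Finset.mul_sum]
    have hone : ∑ k ∈ S, (u i - c) * (u i - u k)⁻¹ + ∑ j ∈ S, (u j - c) * (u j - u i)⁻¹
        = S.card := by
      rw [← Finset.sum_add_distrib, Finset.card_eq_sum_ones, Nat.cast_sum]
      refine Finset.sum_congr rfl fun j hj => ?_
      have h1 := hne j hj
      have h2 : u j - u i ≠ 0 := by rw [← neg_sub]; exact neg_ne_zero.2 h1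
      field_simp
      push_cast
      ring
    push_cast
    linarith

theorem sum_quadratic_mul_cross_terms (S : Finset ι) (u : ι → ℝ) (hu : Set.InjOn u S) (A B : ℝ) :
    ∑ j ∈ S, (A + B * u j ^ 2) * ((∑ k ∈ S.erase j, (u j - u k)⁻¹) ^ 2
      - ∑ k ∈ S.erase j, ((u j - u k)⁻¹) ^ 2)
      = B * ((S.card : ℝ) * (S.card - 1) * (S.card - 2) / 3) := by
  induction S using Finset.induction_on with
  | empty => simp
  | insert i S hi ih =>
    have hne : ∀ j ∈ S, u i - u j ≠ 0 := fun j hj h => hi (by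
      rwa [hu (Finset.mem_insert_self i S) (Finset.mem_insert_of_mem hj) (sub_eq_zero.1 h)])
    have hstep : ∀ j ∈ S, (A + B * u j ^ 2) * ((∑ k ∈ (insert i S).erase j, (u j - u k)⁻¹) ^ 2
          - ∑ k ∈ (insert i S).erase j, ((u j - u k)⁻¹) ^ 2)
        = (A + B * u j ^ 2) * ((∑ k ∈ S.erase j, (u j - u k)⁻¹) ^ 2
          - ∑ k ∈ S.erase j, ((u j - u k)⁻¹) ^ 2)
          + ∑ k ∈ S.erase j, 2 * (A + B * u j ^ 2) * (u j - u i)⁻¹ * (u j - u k)⁻¹ := by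
      intro j hj
      have hij : i ≠ j := by rintro rfl; exact hi hj
      rw [Finset.erase_insert_of_ne hij, Finset.sum_insert (by simp [hi]),
        Finset.sum_insert (by simp [hi]), ← Finset.mul_sum]
      ring
    have hsq : (∑ k ∈ S, (u i - u k)⁻¹) ^ 2 - ∑ k ∈ S, ((u i - u k)⁻¹) ^ 2
        = ∑ j ∈ S, ∑ k ∈ S.erase j, (u i - u j)⁻¹ * (u i - u k)⁻¹ := by
      rw [pow_two, Finset.sum_mul_sum, ← Finset.sum_sub_distrib]
      refine Finset.sum_congr rfl fun j hj => ?_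
      rw [← Finset.add_sum_erase S _ hj]
      ring
    have hswap : ∑ j ∈ S, ∑ k ∈ S.erase j, (A + B * u j ^ 2) * (u j - u i)⁻¹ * (u j - u k)⁻¹
        = ∑ j ∈ S, ∑ k ∈ S.erase j, (A + B * u k ^ 2) * (u k - u i)⁻¹ * (u k - u j)⁻¹ := by
      refine Finset.sum_comm' fun j k => ?_
      simp only [Finset.mem_erase]
      tauto
    have hthree : ∑ j ∈ S, ∑ k ∈ S.erase j, 2 * (A + B * u j ^ 2) * (u j - u i)⁻¹ * (u j - u k)⁻¹
        + (A + B * u i ^ 2) * ∑ j ∈ S, ∑ k ∈ S.erase j, (u i - u j)⁻¹ * (u i - u k)⁻¹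
        = B * (S.card * (S.card - 1)) := by
      have hdouble : ∑ j ∈ S, ∑ k ∈ S.erase j,
            2 * (A + B * u j ^ 2) * (u j - u i)⁻¹ * (u j - u k)⁻¹
          = ∑ j ∈ S, ∑ k ∈ S.erase j, (A + B * u j ^ 2) * (u j - u i)⁻¹ * (u j - u k)⁻¹
          + ∑ j ∈ S, ∑ k ∈ S.erase j, (A + B * u k ^ 2) * (u k - u i)⁻¹ * (u k - u j)⁻¹ := by
        rw [← hswap, ← two_mul]
        simp only [Finset.mul_sum, mul_assoc]
      rw [hdouble, Finset.mul_sum, ← Finset.sum_add_distrib, ← Finset.sum_add_distrib]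
      have : ∀ j ∈ S, ∑ k ∈ S.erase j, (A + B * u j ^ 2) * (u j - u i)⁻¹ * (u j - u k)⁻¹
          + ∑ k ∈ S.erase j, (A + B * u k ^ 2) * (u k - u i)⁻¹ * (u k - u j)⁻¹
          + (A + B * u i ^ 2) * ∑ k ∈ S.erase j, (u i - u j)⁻¹ * (u i - u k)⁻¹
          = B * (S.card - 1) := by
        intro j hj
        rw [Finset.mul_sum, ← Finset.sum_add_distrib, ← Finset.sum_add_distrib]
        have hterm : ∀ k ∈ S.erase j, (A + B * u j ^ 2) * (u j - u i)⁻¹ * (u j - u k)⁻¹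
            + (A + B * u k ^ 2) * (u k - u i)⁻¹ * (u k - u j)⁻¹
            + (A + B * u i ^ 2) * ((u i - u j)⁻¹ * (u i - u k)⁻¹) = B := by
          intro k hk
          obtain ⟨hkj, hk⟩ := Finset.mem_erase.1 hk
          have h1 := hne j hj
          have h2 := hne k hk
          have h3 : u j - u k ≠ 0 := fun h => hkj
            (hu (Finset.mem_insert_of_mem hk) (Finset.mem_insert_of_mem hj) (sub_eq_zero.1 h).symm)
          rw [← neg_sub (u i) (u j), ← neg_sub (u i) (u k), ← neg_sub (u j) (u k)]
          simp only [inv_neg]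
          field_simp
          ring
        rw [Finset.sum_congr rfl hterm, Finset.sum_const, Finset.card_erase_of_mem hj,
          nsmul_eq_mul, Nat.cast_pred (Finset.card_pos.2 ⟨j, hj⟩)]
        ring
      rw [Finset.sum_congr rfl this, Finset.sum_const, nsmul_eq_mul]
      ring
    rw [Finset.sum_insert hi, Finset.erase_insert hi, Finset.sum_congr rfl hstep,
      Finset.sum_add_distrib, ih (hu.mono (by simp)), Finset.card_insert_of_notMem hi, hsq]
    push_cast
    linarith

/-- Points of an interval of length `b - a` have a large total inverse square distance. -/
theorem le_sum_inv_sq_dist (S : Finset ι) (x : ι → ℝ) (hx : Set.InjOn x S) {a b : ℝ}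
    (hS : ∀ j ∈ S, x j ∈ Set.Icc a b) (hab : a < b) :
    (S.card : ℝ) * (S.card - 1) ^ 2 / (b - a) ^ 2
      ≤ ∑ j ∈ S, ∑ k ∈ S.erase j, ((x j - x k)⁻¹) ^ 2 := by
  have hT := sum_quadratic_mul_cross_terms S x hx 1 0
  have hP := sum_erase_div_sub S x hx ((a + b) / 2)
  have hCS := Finset.sum_mul_sq_le_sq_mul_sq S (fun j => x j - (a + b) / 2)
    (fun j => ∑ k ∈ S.erase j, (x j - x k)⁻¹)
  simp only [zero_mul, add_zero, one_mul, Finset.sum_sub_distrib] at hT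
  rw [hP, sub_eq_zero.1 hT] at hCS
  have hvar : ∑ j ∈ S, (x j - (a + b) / 2) ^ 2 ≤ S.card * ((b - a) ^ 2 / 4) := by
    rw [← nsmul_eq_mul]
    refine Finset.sum_le_card_nsmul _ _ _ fun j hj => ?_
    obtain ⟨h1, h2⟩ := hS j hj
    nlinarith
  set V := ∑ j ∈ S, ∑ k ∈ S.erase j, ((x j - x k)⁻¹) ^ 2
  have hV : 0 ≤ V := Finset.sum_nonneg fun _ _ => Finset.sum_nonneg fun _ _ => sq_nonneg _
  rw [div_le_iff₀ (by have := sub_pos.2 hab; positivity)]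
  rcases S.card.eq_zero_or_pos with h0 | hpos
  · rw [h0]; simp; positivity
  · have hc : (0 : ℝ) < S.card := by exact_mod_cast hpos
    have := hCS.trans (mul_le_mul_of_nonneg_right hvar hV)
    refine le_of_mul_le_mul_left ?_ hc
    nlinarith

end PairSums

section Coordinates
variable {N : ℕ}

/-- Inserting a value for the `j`-th coordinate. -/
def insertCoord (j : Fin N) :
    ℝ × ({k : Fin N // k ≠ j} → ℝ) ≃ᵐ (Fin N → ℝ) :=
  ((MeasurableEquiv.funUnique {k : Fin N // k = j} ℝ).symm.prodCongr
    (MeasurableEquiv.refl _)).trans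
    (MeasurableEquiv.piEquivPiSubtypeProd (fun _ : Fin N => ℝ) (fun k => k = j)).symm

theorem insertCoord_apply (j : Fin N) (y : ℝ) (z : {k : Fin N // k ≠ j} → ℝ) :
    insertCoord j (y, z) = fun k => if h : k = j then y else z ⟨k, h⟩ := rfl

@[simp] theorem insertCoord_self (j : Fin N) (y : ℝ) (z : {k : Fin N // k ≠ j} → ℝ) :
    insertCoord j (y, z) j = y := by simp [insertCoord_apply]

theorem insertCoord_of_ne {j k : Fin N} (h : k ≠ j) (y : ℝ) (z : {k : Fin N // k ≠ j} → ℝ) :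
    insertCoord j (y, z) k = z ⟨k, h⟩ := by simp [insertCoord_apply, h]

theorem measurePreserving_insertCoord (j : Fin N) : MeasurePreserving (insertCoord j) := by
  have h := ((volume_preserving_funUnique {k : Fin N // k = j} ℝ).symm).prod
    (MeasurePreserving.id (volume : Measure ({k : Fin N // k ≠ j} → ℝ)))
  refine (volume_preserving_piEquivPiSubtypeProd
    (fun _ : Fin N => ℝ) (fun k => k = j)).symm.comp (g := MeasurableEquiv.symm _) ?_
  convert h using 1
  · rfl
  · rfl
  · rw [Measure.volume_eq_prod]
    congr!

theorem integrable_comp_insertCoord {f : (Fin N → ℝ) → ℝ} (hf : Integrable f) (j : Fin N) :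
    Integrable (fun p => f (insertCoord j p)) (volume.prod volume) :=
  (measurePreserving_insertCoord j).integrable_comp_of_integrable hf

theorem integral_eq_integral_insertCoord {f : (Fin N → ℝ) → ℝ} (hf : Integrable f) (j : Fin N) :
    ∫ x, f x = ∫ y, ∫ z, f (insertCoord j (y, z)) := by
  rw [← (measurePreserving_insertCoord j).integral_comp' (g := f)]
  exact integral_prod _ (integrable_comp_insertCoord hf j)

theorem integral_eq_integral_insertCoord_symm {f : (Fin N → ℝ) → ℝ} (hf : Integrable f)
    (j : Fin N) : ∫ x, f x = ∫ z, ∫ y, f (insertCoord j (y, z)) := by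
  rw [← (measurePreserving_insertCoord j).integral_comp' (g := f)]
  exact integral_prod_symm _ (integrable_comp_insertCoord hf j)

theorem hasDerivAt_insertCoord (j : Fin N) (y : ℝ) (z : {k : Fin N // k ≠ j} → ℝ) :
    HasDerivAt (fun y => insertCoord j (y, z)) (Pi.single j 1) y := by
  refine hasDerivAt_pi.2 fun k => ?_
  by_cases h : k = j
  · subst h
    simp only [insertCoord_self, Pi.single_eq_same]
    exact hasDerivAt_id y
  · simp only [insertCoord_of_ne h, Pi.single_eq_of_ne h]
    exact hasDerivAt_const y (z ⟨k, h⟩)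

end Coordinates

section Drift

/-- The affine map from `[a, b]` onto `[0, π]`. -/
noncomputable def angle (a b y : ℝ) : ℝ := Real.pi / (b - a) * (y - a)

/-- The logarithmic derivative in `s` of `cos (angle s) - cos (angle t)`, the two-particle factor of
the ground state of free fermions on `[a, b]` with Neumann boundary conditions. -/
noncomputable def pairDrift (a b s t : ℝ) : ℝ :=
  -(Real.pi / (b - a)) * Real.sin (angle a b s) *
    (Real.cos (angle a b s) - Real.cos (angle a b t))⁻¹

/-- The derivative of `pairDrift` in its first particle coordinate. -/
noncomputable def pairDriftDeriv (a b s t : ℝ) : ℝ :=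
  (Real.pi / (b - a)) ^ 2 *
    (-Real.cos (angle a b s) * (Real.cos (angle a b s) - Real.cos (angle a b t))⁻¹ -
      Real.sin (angle a b s) ^ 2 * ((Real.cos (angle a b s) - Real.cos (angle a b t))⁻¹) ^ 2)

theorem injOn_cos_angle {a b : ℝ} (hab : a < b) :
    Set.InjOn (fun y => Real.cos (angle a b y)) (Set.Icc a b) := by
  have hpos : 0 < Real.pi / (b - a) := div_pos Real.pi_pos (sub_pos.2 hab)
  refine Real.injOn_cos.comp (fun x _ y _ h => ?_) fun y hy => ⟨?_, ?_⟩
  · simpa [angle, hpos.ne'] using h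
  · exact mul_nonneg hpos.le (sub_nonneg.2 hy.1)
  · calc Real.pi / (b - a) * (y - a) ≤ Real.pi / (b - a) * (b - a) := by
          gcongr; exact hy.2
      _ = Real.pi := div_mul_cancel₀ _ (sub_pos.2 hab).ne'

theorem cos_angle_sub_ne_zero {a b s t : ℝ} (hab : a < b) (hs : s ∈ Set.Icc a b)
    (ht : t ∈ Set.Icc a b) (hst : s ≠ t) :
    Real.cos (angle a b s) - Real.cos (angle a b t) ≠ 0 :=
  sub_ne_zero.2 fun h => hst (injOn_cos_angle hab hs ht h)

theorem hasDerivAt_pairDrift {a b s t : ℝ}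
    (h : Real.cos (angle a b s) - Real.cos (angle a b t) ≠ 0) :
    HasDerivAt (fun s => pairDrift a b s t) (pairDriftDeriv a b s t) s := by
  have hang : HasDerivAt (angle a b) (Real.pi / (b - a)) s := by
    have := ((hasDerivAt_id s).sub_const a).const_mul (Real.pi / (b - a))
    rwa [mul_one] at this
  have h1 := ((hang.sin).const_mul (-(Real.pi / (b - a)))).mul
    ((hang.cos.sub_const (Real.cos (angle a b t))).inv h)
  refine h1.congr_deriv ?_
  rw [pairDriftDeriv, Pi.inv_apply]
  field_simp
  ring

@[simp] theorem pairDrift_left (a b t : ℝ) : pairDrift a b a t = 0 := by simp [pairDrift, angle]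

theorem pairDrift_right {a b : ℝ} (hab : a < b) (t : ℝ) : pairDrift a b b t = 0 := by
  simp [pairDrift, angle, div_mul_cancel₀ _ (sub_pos.2 hab).ne']

theorem continuous_angle (a b : ℝ) : Continuous (angle a b) := by
  unfold angle; fun_prop

variable {N : ℕ}

/-- The derivative in `x j` of `pairDrift (x j) (x k) * ‖ψ x‖ ^ 2`. -/
noncomputable def driftFlux (a b : ℝ) (ψ : (Fin N → ℝ) → ℂ) (j k : Fin N) (x : Fin N → ℝ) : ℝ :=
  pairDriftDeriv a b (x j) (x k) * ‖ψ x‖ ^ 2 +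
    pairDrift a b (x j) (x k) * (2 * inner ℝ (ψ x) (fderiv ℝ ψ x (Pi.single j 1)))

/-- The configurations whose `j`-th and `k`-th particles lie in `[a, b]`. -/
def pairBox (a b : ℝ) (j k : Fin N) : Set (Fin N → ℝ) :=
  {x | x j ∈ Set.Icc a b ∧ x k ∈ Set.Icc a b}

theorem isClosed_pairBox (a b : ℝ) (j k : Fin N) : IsClosed (pairBox a b j k) :=
  (isClosed_Icc.preimage (continuous_apply j)).inter (isClosed_Icc.preimage (continuous_apply k))

/-- A function that vanishes wherever `ψ` does and is continuous on the part of the support of `ψ`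
inside a closed set is integrable on that set. -/
theorem integrable_indicator_of_continuousOn_tsupport {ψ : (Fin N → ℝ) → ℂ}
    (hcs : HasCompactSupport ψ) {s : Set (Fin N → ℝ)} (hs : IsClosed s) {f : (Fin N → ℝ) → ℝ}
    (hf : ContinuousOn f (tsupport ψ ∩ s)) (hzero : ∀ x, ψ x = 0 → f x = 0) :
    Integrable (s.indicator f) := by
  have hcomp : IsCompact (tsupport ψ ∩ s) := hcs.isCompact.inter_right hs
  have heq : s.indicator f = (tsupport ψ ∩ s).indicator f := by
    ext x
    by_cases hx : x ∈ tsupport ψ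
    · by_cases hxs : x ∈ s <;> simp [hx, hxs]
    · by_cases hxs : x ∈ s <;> simp [hx, hxs, hzero x (image_eq_zero_of_notMem_tsupport hx)]
  rw [heq]
  exact (hf.integrableOn_compact hcomp).integrable_indicator hcomp.measurableSet

variable {ψ : (Fin N → ℝ) → ℂ}

theorem continuous_fderiv_single (hψ : ContDiff ℝ (⊤ : ℕ∞) ψ) (j : Fin N) :
    Continuous fun x => fderiv ℝ ψ x (Pi.single j 1) :=
  (hψ.continuous_fderiv (by simp)).clm_apply continuous_const

theorem integrable_driftFlux (hψ : ContDiff ℝ (⊤ : ℕ∞) ψ) (hcs : HasCompactSupport ψ)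
    (hoff : ∀ x ∈ tsupport ψ, Function.Injective x) {a b : ℝ} (hab : a < b) {j k : Fin N}
    (hjk : k ≠ j) : Integrable ((pairBox a b j k).indicator (driftFlux a b ψ j k)) := by
  refine integrable_indicator_of_continuousOn_tsupport hcs (isClosed_pairBox a b j k) ?_
    fun x hx => by simp [driftFlux, hx]
  have hang := continuous_angle a b
  have hψc := hψ.continuous
  have hd := continuous_fderiv_single hψ j
  have hinv : ContinuousOn (fun x : Fin N → ℝ =>
      (Real.cos (angle a b (x j)) - Real.cos (angle a b (x k)))⁻¹)
      (tsupport ψ ∩ pairBox a b j k) := by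
    refine ContinuousOn.inv₀ (by fun_prop) fun x hx => ?_
    exact cos_angle_sub_ne_zero hab hx.2.1 hx.2.2 fun h => hjk (hoff x hx.1 h).symm
  unfold driftFlux pairDrift pairDriftDeriv
  fun_prop

theorem hasDerivAt_pairDrift_mul_norm_sq (hψ : ContDiff ℝ (⊤ : ℕ∞) ψ)
    (hoff : ∀ x ∈ tsupport ψ, Function.Injective x) {a b : ℝ} (hab : a < b) {j k : Fin N}
    (hjk : k ≠ j) {z : {k : Fin N // k ≠ j} → ℝ} (hz : z ⟨k, hjk⟩ ∈ Set.Icc a b) {y : ℝ}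
    (hy : y ∈ Set.Icc a b) :
    HasDerivAt (fun y => pairDrift a b y (z ⟨k, hjk⟩) * ‖ψ (insertCoord j (y, z))‖ ^ 2)
      (driftFlux a b ψ j k (insertCoord j (y, z))) y := by
  have hins := hasDerivAt_insertCoord j y z
  by_cases hx : insertCoord j (y, z) ∈ tsupport ψ
  · have hne : y ≠ z ⟨k, hjk⟩ := fun h => hjk <| (hoff _ hx (a₁ := j) (a₂ := k) (by
      rw [insertCoord_self, insertCoord_of_ne hjk, h])).symm
    have hu : HasDerivAt (fun y => ψ (insertCoord j (y, z)))
        (fderiv ℝ ψ (insertCoord j (y, z)) (Pi.single j 1)) y :=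
      ((hψ.differentiable (by simp)) _).hasFDerivAt.comp_hasDerivAt y hins
    have := (hasDerivAt_pairDrift (cos_angle_sub_ne_zero hab hy hz hne)).mul hu.norm_sq
    rw [driftFlux, insertCoord_self, insertCoord_of_ne hjk]
    exact this
  · have hev : ∀ᶠ y' in nhds y, insertCoord j (y', z) ∉ tsupport ψ :=
      hins.continuousAt.eventually ((isClosed_tsupport ψ).isOpen_compl.eventually_mem hx)
    have hflux : driftFlux a b ψ j k (insertCoord j (y, z)) = 0 := by
      simp [driftFlux, image_eq_zero_of_notMem_tsupport hx]
    rw [hflux]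
    refine (hasDerivAt_const y (0 : ℝ)).congr_of_eventuallyEq ?_
    filter_upwards [hev] with y' hy'
    simp [image_eq_zero_of_notMem_tsupport hy']

theorem integral_driftFlux (hψ : ContDiff ℝ (⊤ : ℕ∞) ψ) (hcs : HasCompactSupport ψ)
    (hoff : ∀ x ∈ tsupport ψ, Function.Injective x) {a b : ℝ} (hab : a < b) {j k : Fin N}
    (hjk : k ≠ j) : ∫ x, (pairBox a b j k).indicator (driftFlux a b ψ j k) x = 0 := by
  have hint := integrable_driftFlux hψ hcs hoff hab hjk
  rw [integral_eq_integral_insertCoord_symm hint j]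
  refine integral_eq_zero_of_ae ?_
  filter_upwards [(integrable_comp_insertCoord hint j).prod_left_ae] with z hzint
  by_cases hz : z ⟨k, hjk⟩ ∈ Set.Icc a b
  · have heq : (fun y => (pairBox a b j k).indicator (driftFlux a b ψ j k) (insertCoord j (y, z)))
        = (Set.Icc a b).indicator fun y => driftFlux a b ψ j k (insertCoord j (y, z)) := by
      ext y
      simp only [Set.indicator, pairBox, Set.mem_ofPred_eq, insertCoord_self,
        insertCoord_of_ne hjk, hz, and_true]
    rw [heq, integrable_indicator_iff measurableSet_Icc] at hzint
    rw [heq, integral_indicator measurableSet_Icc, integral_Icc_eq_integral_Ioc,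
      ← intervalIntegral.integral_of_le hab.le,
      intervalIntegral.integral_eq_sub_of_hasDerivAt (fun y hy =>
        hasDerivAt_pairDrift_mul_norm_sq hψ hoff hab hjk hz (by rwa [Set.uIcc_of_le hab.le] at hy))
        ((intervalIntegrable_iff_integrableOn_Icc_of_le hab.le).2 hzint)]
    simp [pairDrift_right hab]
  · have heq : (fun y => (pairBox a b j k).indicator (driftFlux a b ψ j k) (insertCoord j (y, z)))
        = 0 := by
      ext y
      simp only [Set.indicator, pairBox, Set.mem_ofPred_eq, insertCoord_self,
        insertCoord_of_ne hjk, hz, and_false, if_false, Pi.zero_apply]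
    rw [heq]
    simp

end Drift

section Energy

variable {N : ℕ} {ψ : (Fin N → ℝ) → ℂ}

theorem sum_neg_pairDriftDeriv_sub_sq {ι : Type*} [DecidableEq ι] (S : Finset ι) (x : ι → ℝ)
    (hx : Set.InjOn x S) {a b : ℝ} (hS : ∀ j ∈ S, x j ∈ Set.Icc a b) (hab : a < b) :
    ∑ j ∈ S, (-(∑ k ∈ S.erase j, pairDriftDeriv a b (x j) (x k))
      - (∑ k ∈ S.erase j, pairDrift a b (x j) (x k)) ^ 2)
      = (Real.pi / (b - a)) ^ 2 * ((S.card : ℝ) * (S.card - 1) * (2 * S.card - 1) / 6) := by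
  set u : ι → ℝ := fun j => Real.cos (angle a b (x j)) with hudef
  have hu : Set.InjOn u S := (injOn_cos_angle hab).comp hx fun j hj => hS j hj
  have hT := sum_quadratic_mul_cross_terms S u hu 1 (-1)
  have hP := sum_erase_div_sub S u hu 0
  have hterm : ∀ j ∈ S, -(∑ k ∈ S.erase j, pairDriftDeriv a b (x j) (x k))
      - (∑ k ∈ S.erase j, pairDrift a b (x j) (x k)) ^ 2
      = (Real.pi / (b - a)) ^ 2 * ((u j - 0) * ∑ k ∈ S.erase j, (u j - u k)⁻¹
        - (1 + -1 * u j ^ 2) * ((∑ k ∈ S.erase j, (u j - u k)⁻¹) ^ 2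
          - ∑ k ∈ S.erase j, ((u j - u k)⁻¹) ^ 2)) := by
    intro j _
    have hsin : Real.sin (angle a b (x j)) ^ 2 = 1 - u j ^ 2 := Real.sin_sq _
    have h1 : ∑ k ∈ S.erase j, pairDriftDeriv a b (x j) (x k)
        = (Real.pi / (b - a)) ^ 2 * (-u j * ∑ k ∈ S.erase j, (u j - u k)⁻¹
          - (1 - u j ^ 2) * ∑ k ∈ S.erase j, ((u j - u k)⁻¹) ^ 2) := by
      simp only [pairDriftDeriv, hsin, Finset.mul_sum, ← Finset.sum_sub_distrib, hudef]
    have h2 : ∑ k ∈ S.erase j, pairDrift a b (x j) (x k)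
        = -(Real.pi / (b - a)) * Real.sin (angle a b (x j)) * ∑ k ∈ S.erase j, (u j - u k)⁻¹ := by
      simp only [pairDrift, Finset.mul_sum, hudef]
    rw [h1, h2, mul_pow, mul_pow, hsin]
    ring
  rw [Finset.sum_congr rfl hterm, ← Finset.mul_sum, Finset.sum_sub_distrib, hP, hT]
  ring

theorem sum_driftFlux_add_le (x : Fin N → ℝ) (S : Finset (Fin N)) {a b : ℝ} (hab : a < b)
    (hS : ∀ j ∈ S, x j ∈ Set.Icc a b) (hinj : ψ x ≠ 0 → Set.InjOn x S) :
    (Real.pi / (b - a)) ^ 2 * ((S.card : ℝ) * (S.card - 1) * (2 * S.card - 1) / 6) * ‖ψ x‖ ^ 2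
      + ∑ j ∈ S, ∑ k ∈ S.erase j, driftFlux a b ψ j k x
      ≤ ∑ j ∈ S, ‖fderiv ℝ ψ x (Pi.single j 1)‖ ^ 2 := by
  by_cases h0 : ψ x = 0
  · simp only [driftFlux, h0, norm_zero, inner_zero_left]
    simp only [ne_eq, OfNat.ofNat_ne_zero, not_false_eq_true, zero_pow, mul_zero, add_zero,
      Finset.sum_const_zero]
    positivity
  · rw [← sum_neg_pairDriftDeriv_sub_sq S x (hinj h0) hS hab, Finset.sum_mul,
      ← Finset.sum_add_distrib]
    refine Finset.sum_le_sum fun j _ => ?_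
    simp only [driftFlux, Finset.sum_add_distrib, ← Finset.sum_mul]
    set G := ∑ k ∈ S.erase j, pairDrift a b (x j) (x k)
    set v := fderiv ℝ ψ x (Pi.single j 1)
    have h := norm_sub_sq_real v (G • ψ x)
    rw [norm_smul, mul_pow, Real.norm_eq_abs, sq_abs, inner_smul_right, real_inner_comm] at h
    have hnn := sq_nonneg ‖v - G • ψ x‖
    linarith

/-- The local energy density of the `j`-th particle. -/
noncomputable def particleEnergy (α : ℝ) (ψ : (Fin N → ℝ) → ℂ) (j : Fin N) (x : Fin N → ℝ) : ℝ :=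
  (1 / 2) * (‖fderiv ℝ ψ x (Pi.single j 1)‖ ^ 2
    + ∑ k ∈ Finset.univ.filter (fun k => k ≠ j), α * (α - 1) * ‖ψ x‖ ^ 2 / (x j - x k) ^ 2)

theorem particleEnergy_nonneg {α : ℝ} (hα : 1 ≤ α) (j : Fin N) (x : Fin N → ℝ) :
    0 ≤ particleEnergy α ψ j x := by
  have : 0 ≤ α - 1 := sub_nonneg.2 hα
  unfold particleEnergy
  positivity

theorem integrable_particleEnergy (α : ℝ) (hψ : ContDiff ℝ (⊤ : ℕ∞) ψ) (hcs : HasCompactSupport ψ)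
    (hoff : ∀ x ∈ tsupport ψ, Function.Injective x) (j : Fin N) :
    Integrable (particleEnergy α ψ j) := by
  refine Integrable.const_mul (Integrable.add ?_ (integrable_finsetSum _ fun k hk => ?_)) _
  · refine ((continuous_fderiv_single hψ j).norm.pow 2).integrable_of_hasCompactSupport ?_
    exact (hcs.fderiv_apply ℝ (Pi.single j 1)).mono fun x hx h => hx (by simp [h])
  · rw [← Set.indicator_univ (fun x : Fin N → ℝ => α * (α - 1) * ‖ψ x‖ ^ 2 / (x j - x k) ^ 2)]
    refine integrable_indicator_of_continuousOn_tsupport hcs isClosed_univ ?_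
      fun x hx => by simp [hx]
    have hψc := hψ.continuous
    refine ContinuousOn.div (by fun_prop) (by fun_prop) fun x hx => ?_
    exact pow_ne_zero 2 (sub_ne_zero.2 fun h => (Finset.mem_filter.1 hk).2 (hoff x hx.1 h).symm)

/-- The configurations whose `j`-th particle lies in `[a, b]`. -/
def coordStrip (a b : ℝ) (j : Fin N) : Set (Fin N → ℝ) := {x | x j ∈ Set.Icc a b}

theorem isClosed_coordStrip (a b : ℝ) (j : Fin N) : IsClosed (coordStrip a b j) :=
  isClosed_Icc.preimage (continuous_apply j)

theorem cubic_tangent_le {m n : ℝ} (hm : 0 ≤ m) (hn : 0 ≤ n) :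
    (n ^ 3 - n) / 24 + (3 * n ^ 2 - 1) / 24 * (m - n) ≤ (m ^ 3 - m) / 24 := by
  nlinarith [mul_nonneg (add_nonneg hm (add_nonneg hn hn)) (sq_nonneg (m - n))]

/-- The energy of `m` particles in `[a, b]` dominates, up to a flux, the tangent at `n` of a cubic
function of `m`. -/
theorem tangent_add_flux_le_energy {α : ℝ} (hα : 1 ≤ α) (x : Fin N → ℝ) {a b n : ℝ} (hab : a < b)
    (hn : 0 ≤ n) (hinj : ψ x ≠ 0 → Function.Injective x) :
    (Real.pi ^ 2 / 4 + α * (α - 1)) / (b - a) ^ 2 *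
        (((n ^ 3 - n) / 24 - (3 * n ^ 2 - 1) / 24 * n) * ‖ψ x‖ ^ 2 + (3 * n ^ 2 - 1) / 24 *
          ∑ j, (coordStrip a b j).indicator (fun x => ‖ψ x‖ ^ 2) x)
      + 1 / 2 * ∑ j, ∑ k ∈ Finset.univ.erase j, (pairBox a b j k).indicator (driftFlux a b ψ j k) x
      ≤ ∑ j, (coordStrip a b j).indicator (particleEnergy α ψ j) x := by
  classical
  set S : Finset (Fin N) := Finset.univ.filter fun j => x j ∈ Set.Icc a b with hSdef
  have hS : ∀ j ∈ S, x j ∈ Set.Icc a b := fun j hj => (Finset.mem_filter.1 hj).2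
  have hind : ∀ f : Fin N → (Fin N → ℝ) → ℝ,
      ∑ j, (coordStrip a b j).indicator (f j) x = ∑ j ∈ S, f j x := by
    intro f
    rw [hSdef, Finset.sum_filter]
    refine Finset.sum_congr rfl fun j _ => ?_
    by_cases hj : x j ∈ Set.Icc a b
    · rw [if_pos hj]; exact Set.indicator_of_mem (s := coordStrip a b j) hj _
    · rw [if_neg hj]; exact Set.indicator_of_notMem (s := coordStrip a b j) hj _
  have hcount : ∑ j, (coordStrip a b j).indicator (fun x => ‖ψ x‖ ^ 2) x = S.card * ‖ψ x‖ ^ 2 := by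
    rw [hind fun _ x => ‖ψ x‖ ^ 2, Finset.sum_const, nsmul_eq_mul]
  have hflux : ∑ j, ∑ k ∈ Finset.univ.erase j,
      (pairBox a b j k).indicator (driftFlux a b ψ j k) x
      = ∑ j ∈ S, ∑ k ∈ S.erase j, driftFlux a b ψ j k x := by
    rw [hSdef, Finset.sum_filter]
    refine Finset.sum_congr rfl fun j _ => ?_
    by_cases hj : x j ∈ Set.Icc a b
    · rw [if_pos hj, ← Finset.filter_erase, Finset.sum_filter]
      simp only [Set.indicator, pairBox, Set.mem_ofPred_eq, hj, true_and]
    · rw [if_neg hj]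
      simp only [Set.indicator, pairBox, Set.mem_ofPred_eq, hj, false_and, if_false,
        Finset.sum_const_zero]
  have hc : 0 ≤ α * (α - 1) := mul_nonneg (by linarith) (by linarith)
  have hL : 0 < b - a := sub_pos.2 hab
  have hpot : 1 / 2 * ∑ j ∈ S, ‖fderiv ℝ ψ x (Pi.single j 1)‖ ^ 2
      + 1 / 2 * (α * (α - 1) * ‖ψ x‖ ^ 2 * ∑ j ∈ S, ∑ k ∈ S.erase j, ((x j - x k)⁻¹) ^ 2)
      ≤ ∑ j ∈ S, particleEnergy α ψ j x := by
    simp only [particleEnergy, ← Finset.mul_sum, Finset.sum_add_distrib, mul_add]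
    gcongr
    simp only [Finset.mul_sum]
    refine Finset.sum_le_sum fun j _ => ?_
    simp only [inv_pow, ← div_eq_mul_inv]
    refine Finset.sum_le_sum_of_subset_of_nonneg (fun k hk => ?_) fun k _ _ => by positivity
    simpa using (Finset.mem_erase.1 hk).1
  rw [hcount, hflux, hind]
  refine le_trans ?_ hpot
  have hkin := sum_driftFlux_add_le x S hab hS fun h => (hinj h).injOn
  suffices hmain : (Real.pi ^ 2 / 4 + α * (α - 1)) / (b - a) ^ 2 *
      ((n ^ 3 - n) / 24 + (3 * n ^ 2 - 1) / 24 * (S.card - n)) * ‖ψ x‖ ^ 2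
      ≤ 1 / 2 * ((Real.pi / (b - a)) ^ 2 *
          ((S.card : ℝ) * (S.card - 1) * (2 * S.card - 1) / 6) * ‖ψ x‖ ^ 2)
        + 1 / 2 * (α * (α - 1) * ‖ψ x‖ ^ 2 *
          ∑ j ∈ S, ∑ k ∈ S.erase j, ((x j - x k)⁻¹) ^ 2) by
    linarith
  by_cases h0 : ψ x = 0
  · simp [h0]
  have hV := le_sum_inv_sq_dist S x (hinj h0).injOn hS hab
  have htan := cubic_tangent_le (Nat.cast_nonneg (α := ℝ) S.card) hn
  generalize (S.card) = m at hV htan ⊢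
  have hkinm : ((m : ℝ) ^ 3 - m) / 24 * (1 / 4) ≤ 1 / 2 * ((m : ℝ) * (m - 1) * (2 * m - 1) / 6) ∧
      ((m : ℝ) ^ 3 - m) / 24 ≤ 1 / 2 * (m * (m - 1) ^ 2) := by
    rcases m with _ | _ | m
    · norm_num
    · norm_num
    · have : (0 : ℝ) ≤ m := Nat.cast_nonneg m
      push_cast
      constructor <;> nlinarith [mul_nonneg this this, mul_nonneg (mul_nonneg this this) this]
  calc (Real.pi ^ 2 / 4 + α * (α - 1)) / (b - a) ^ 2 *
      ((n ^ 3 - n) / 24 + (3 * n ^ 2 - 1) / 24 * (m - n)) * ‖ψ x‖ ^ 2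
      ≤ (Real.pi ^ 2 / 4 + α * (α - 1)) / (b - a) ^ 2 * (((m : ℝ) ^ 3 - m) / 24) * ‖ψ x‖ ^ 2 := by
        gcongr
    _ = (Real.pi / (b - a)) ^ 2 * (((m : ℝ) ^ 3 - m) / 24 * (1 / 4)) * ‖ψ x‖ ^ 2
        + α * (α - 1) * ‖ψ x‖ ^ 2 * ((((m : ℝ) ^ 3 - m) / 24) / (b - a) ^ 2) := by
        field_simp
    _ ≤ (Real.pi / (b - a)) ^ 2 * (1 / 2 * ((m : ℝ) * (m - 1) * (2 * m - 1) / 6)) * ‖ψ x‖ ^ 2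
        + α * (α - 1) * ‖ψ x‖ ^ 2 * ((1 / 2 * (m * (m - 1) ^ 2)) / (b - a) ^ 2) := by
        obtain ⟨hk, hp⟩ := hkinm
        exact add_le_add (mul_le_mul_of_nonneg_right (mul_le_mul_of_nonneg_left hk (sq_nonneg _))
          (sq_nonneg _)) (mul_le_mul_of_nonneg_left (div_le_div_of_nonneg_right hp (sq_nonneg _))
          (mul_nonneg hc (sq_nonneg _)))
    _ = 1 / 2 * ((Real.pi / (b - a)) ^ 2 * ((m : ℝ) * (m - 1) * (2 * m - 1) / 6) * ‖ψ x‖ ^ 2)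
        + 1 / 2 * (α * (α - 1) * ‖ψ x‖ ^ 2 * (m * (m - 1) ^ 2 / (b - a) ^ 2)) := by ring
    _ ≤ _ := by gcongr

theorem integrable_norm_sq (hψ : Continuous ψ) (hcs : HasCompactSupport ψ) :
    Integrable fun x => ‖ψ x‖ ^ 2 :=
  (hψ.norm.pow 2).integrable_of_hasCompactSupport
    (hcs.mono fun x hx h => hx (by simp [h]))

theorem setIntegral_densityAt (hψ : Continuous ψ) (hcs : HasCompactSupport ψ) (j : Fin N)
    {s : Set ℝ} (hs : MeasurableSet s) :
    ∫ y in s, densityAt ψ j y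
      = ∫ x, ((fun x : Fin N → ℝ => x j) ⁻¹' s).indicator (fun x => ‖ψ x‖ ^ 2) x := by
  rw [integral_eq_integral_insertCoord
    ((integrable_norm_sq hψ hcs).indicator (hs.preimage (measurable_pi_apply j))) j,
    ← integral_indicator hs]
  refine integral_congr_ae (ae_of_all _ fun y => ?_)
  by_cases hy : y ∈ s
  · simp only [Set.indicator, Set.mem_preimage, insertCoord_self, hy, if_true]
    rfl
  · simp only [Set.indicator, Set.mem_preimage, insertCoord_self, hy, if_false, integral_zero]

theorem integral_comp_perm (f : (Fin N → ℝ) → ℝ) (σ : Equiv.Perm (Fin N)) :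
    ∫ x : Fin N → ℝ, f (x ∘ σ) = ∫ x, f x := by
  have h := (volume_measurePreserving_piCongrLeft (fun _ : Fin N => ℝ) σ.symm).integral_comp'
    (g := f)
  rw [← h]
  congr 1 with x
  congr 1 with i
  obtain ⟨k, rfl⟩ := σ.symm.surjective i
  rw [MeasurableEquiv.coe_piCongrLeft, Equiv.piCongrLeft_apply_apply]
  simp

theorem card_mul_setIntegral_densityAt (hψ : Continuous ψ) (hcs : HasCompactSupport ψ)
    (hsym : ∀ (σ : Equiv.Perm (Fin N)) (x : Fin N → ℝ), ψ (x ∘ σ) = ψ x) (i : Fin N) (a b : ℝ) :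
    ∫ y in Set.Icc a b, (N : ℝ) * densityAt ψ i y
      = ∑ j, ∫ x, (coordStrip a b j).indicator (fun x => ‖ψ x‖ ^ 2) x := by
  have hj : ∀ j : Fin N, ∫ x, (coordStrip a b j).indicator (fun x => ‖ψ x‖ ^ 2) x
      = ∫ y in Set.Icc a b, densityAt ψ i y := by
    intro j
    rw [setIntegral_densityAt hψ hcs i measurableSet_Icc,
      ← integral_comp_perm _ (Equiv.swap i j)]
    congr 1
    ext x
    simp [Set.indicator, coordStrip, hsym]
  simp [hj, integral_const_mul]

theorem local_energy_lower_bound {α : ℝ} (hα : 1 ≤ α) (hψ : ContDiff ℝ (⊤ : ℕ∞) ψ)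
    (hcs : HasCompactSupport ψ) (hoff : ∀ x ∈ tsupport ψ, Function.Injective x)
    (hnorm : ∫ x : Fin N → ℝ, ‖ψ x‖ ^ 2 = 1) {a b n : ℝ} (hab : a < b) (hn : 2 ≤ n)
    (hdens : ∑ j, ∫ x, (coordStrip a b j).indicator (fun x => ‖ψ x‖ ^ 2) x = n) :
    (1 / 32) * (Real.pi ^ 2 / 4 + α * (α - 1)) * n ^ 3 / (b - a) ^ 2
      ≤ ∑ j : Fin N, ∫ x, (coordStrip a b j).indicator (particleEnergy α ψ j) x := by
  have hL : 0 < b - a := sub_pos.2 hab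
  have hc : 0 ≤ α * (α - 1) := mul_nonneg (by linarith) (by linarith)
  have hsq := integrable_norm_sq hψ.continuous hcs
  have hstrip : ∀ j ∈ Finset.univ,
      Integrable ((coordStrip a b j).indicator fun x : Fin N → ℝ => ‖ψ x‖ ^ 2) :=
    fun j _ => hsq.indicator (isClosed_coordStrip a b j).measurableSet
  have hE : ∀ j ∈ Finset.univ, Integrable ((coordStrip a b j).indicator (particleEnergy α ψ j)) :=
    fun j _ => (integrable_particleEnergy α hψ hcs hoff j).indicator
      (isClosed_coordStrip a b j).measurableSet
  have hfl : ∀ j : Fin N, ∀ k ∈ Finset.univ.erase j,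
      Integrable ((pairBox a b j k).indicator (driftFlux a b ψ j k)) :=
    fun j k hk => integrable_driftFlux hψ hcs hoff hab (Finset.ne_of_mem_erase hk)
  have hflsum : ∀ j ∈ Finset.univ, Integrable fun x => ∑ k ∈ Finset.univ.erase j,
      (pairBox a b j k).indicator (driftFlux a b ψ j k) x :=
    fun j _ => integrable_finsetSum _ (hfl j)
  have hflzero : ∫ x, ∑ j : Fin N, ∑ k ∈ Finset.univ.erase j,
      (pairBox a b j k).indicator (driftFlux a b ψ j k) x = 0 := by
    rw [integral_finsetSum _ hflsum]
    refine Finset.sum_eq_zero fun j _ => ?_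
    rw [integral_finsetSum _ (hfl j)]
    exact Finset.sum_eq_zero fun k hk =>
      integral_driftFlux hψ hcs hoff hab (Finset.ne_of_mem_erase hk)
  have hI1 := hsq.const_mul ((n ^ 3 - n) / 24 - (3 * n ^ 2 - 1) / 24 * n)
  have hI2 := (integrable_finsetSum _ hstrip).const_mul ((3 * n ^ 2 - 1) / 24)
  have hI3 := (hI1.add hI2).const_mul ((Real.pi ^ 2 / 4 + α * (α - 1)) / (b - a) ^ 2)
  have hI4 := (integrable_finsetSum _ hflsum).const_mul (1 / 2)
  have hmono := integral_mono (hI3.add hI4) (integrable_finsetSum _ hE) fun x =>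
    tangent_add_flux_le_energy (ψ := ψ) hα x hab (by linarith : 0 ≤ n)
      fun h => hoff x (subset_tsupport ψ h)
  rw [integral_finsetSum _ hE] at hmono
  refine le_trans ?_ hmono
  rw [integral_add' hI3 hI4, integral_const_mul, integral_const_mul, hflzero, integral_add' hI1 hI2,
    integral_const_mul, integral_const_mul, hnorm, integral_finsetSum _ hstrip, hdens]
  have hcub : n ^ 3 / 32 ≤ (n ^ 3 - n) / 24 := by
    have h1 : 0 ≤ n - 2 := by linarith
    have h2 : 0 ≤ n * (n + 2) := by positivity
    nlinarith [mul_nonneg h1 h2]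
  calc (1 / 32) * (Real.pi ^ 2 / 4 + α * (α - 1)) * n ^ 3 / (b - a) ^ 2
      = (Real.pi ^ 2 / 4 + α * (α - 1)) / (b - a) ^ 2 * (n ^ 3 / 32) := by ring
    _ ≤ (Real.pi ^ 2 / 4 + α * (α - 1)) / (b - a) ^ 2 * ((n ^ 3 - n) / 24) := by gcongr
    _ = _ := by ring

theorem sum_particleEnergy (α : ℝ) (x : Fin N → ℝ) :
    ∑ j, particleEnergy α ψ j x = (1 / 2) * ∑ j : Fin N, ‖fderiv ℝ ψ x (Pi.single j 1)‖ ^ 2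
      + ∑ j : Fin N, ∑ k ∈ Finset.univ.filter (fun k => j < k),
          α * (α - 1) * ‖ψ x‖ ^ 2 / (x j - x k) ^ 2 := by
  set F : Fin N → Fin N → ℝ := fun j k => α * (α - 1) * ‖ψ x‖ ^ 2 / (x j - x k) ^ 2 with hF
  have hsplit : ∀ j : Fin N, ∑ k ∈ Finset.univ.filter (fun k => k ≠ j), F j k
      = ∑ k ∈ Finset.univ.filter (fun k => j < k), F j k
        + ∑ k ∈ Finset.univ.filter (fun k => k < j), F j k := by
    intro j
    simp only [Finset.sum_filter, ← Finset.sum_add_distrib]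
    refine Finset.sum_congr rfl fun k _ => ?_
    rcases lt_trichotomy j k with h | h | h
    · simp [h, h.ne', h.not_gt]
    · simp [h]
    · simp [h, h.ne, h.not_gt]
  have hswap : ∑ j : Fin N, ∑ k ∈ Finset.univ.filter (fun k => k < j), F j k
      = ∑ j : Fin N, ∑ k ∈ Finset.univ.filter (fun k => j < k), F j k := by
    simp only [Finset.sum_filter]
    rw [Finset.sum_comm]
    simp only [hF, sub_sq_comm]
  simp only [particleEnergy]
  rw [← Finset.mul_sum, Finset.sum_add_distrib, Finset.sum_congr rfl fun j _ => hsplit j,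
    Finset.sum_add_distrib, hswap]
  ring

theorem indicator_particleEnergy (α a b : ℝ) (j : Fin N) (x : Fin N → ℝ) :
    (coordStrip a b j).indicator (particleEnergy α ψ j) x
      = particleEnergy α ψ j x * Set.indicator (Set.Icc a b) (fun _ => (1 : ℝ)) (x j) := by
  by_cases h : x j ∈ Set.Icc a b
  · rw [Set.indicator_of_mem (s := coordStrip a b j) h, Set.indicator_of_mem h, mul_one]
  · rw [Set.indicator_of_notMem (s := coordStrip a b j) h, Set.indicator_of_notMem h, mul_zero]

end Energy

/-- **Lieb–Thirring inequalities for the 1D Calogero–Sutherland model.** For `α ≥ 1`,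
`N ≥ 2` and a normalized symmetric smooth `ψ` vanishing near the diagonals, with
one-particle density `ρ(x) = N∫|ψ(x,x₂,…,x_N)|²`:
(i) for every finite interval `Q₀ = [a,b]` with `∫_{Q₀} ρ ≥ 2`, the local kinetic energy
satisfies `T_H^{Q₀} ≥ (1/32)(π²/4 + α(α-1))(∫_{Q₀}ρ)³/|Q₀|²`; and
(ii) if `ρ` is supported on an interval of length `L`, then the total kinetic energy
satisfies `T_H ≥ (1/32)(π²/4 + α(α-1))N³/L²`. -/
theorem lieb_thirring_calogero_sutherland
    (α : ℝ) (hα : 1 ≤ α) (N : ℕ) (hN : 2 ≤ N)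
    (ψ : (Fin N → ℝ) → ℂ)
    (hψ : ContDiff ℝ (⊤ : ℕ∞) ψ) (hcs : HasCompactSupport ψ)
    (hsym : ∀ (σ : Equiv.Perm (Fin N)) (x : Fin N → ℝ), ψ (x ∘ σ) = ψ x)
    (hnorm : ∫ x : Fin N → ℝ, ‖ψ x‖ ^ 2 = 1)
    (hvan : ∃ U : Set (Fin N → ℝ), IsOpen U ∧
      {x : Fin N → ℝ | ∃ j k : Fin N, j ≠ k ∧ x j = x k} ⊆ U ∧ ∀ x ∈ U, ψ x = 0) :
    (∀ a b : ℝ, a < b →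
      2 ≤ (∫ y in Set.Icc a b, (N : ℝ) * densityAt ψ (⟨0, by omega⟩ : Fin N) y) →
      (∑ j : Fin N, ∫ x : Fin N → ℝ,
          ((1 / 2) * (‖fderiv ℝ ψ x (Pi.single j 1)‖ ^ 2
            + ∑ k ∈ Finset.univ.filter (fun k => k ≠ j),
                α * (α - 1) * ‖ψ x‖ ^ 2 / (x j - x k) ^ 2)) *
            Set.indicator (Set.Icc a b) (fun _ => (1 : ℝ)) (x j))
        ≥ (1 / 32) * (Real.pi ^ 2 / 4 + α * (α - 1)) *
            (∫ y in Set.Icc a b, (N : ℝ) * densityAt ψ (⟨0, by omega⟩ : Fin N) y) ^ 3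
            / (b - a) ^ 2) ∧
    (∀ a L : ℝ, 0 < L →
      (∀ y : ℝ, y ∉ Set.Icc a (a + L) →
        (N : ℝ) * densityAt ψ (⟨0, by omega⟩ : Fin N) y = 0) →
      (∫ x : Fin N → ℝ,
          ((1 / 2) * ∑ j : Fin N, ‖fderiv ℝ ψ x (Pi.single j 1)‖ ^ 2
            + ∑ j : Fin N, ∑ k ∈ Finset.univ.filter (fun k => j < k),
                α * (α - 1) * ‖ψ x‖ ^ 2 / (x j - x k) ^ 2))
        ≥ (1 / 32) * (Real.pi ^ 2 / 4 + α * (α - 1)) * (N : ℝ) ^ 3 / L ^ 2) := by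
  have hoff : ∀ x ∈ tsupport ψ, Function.Injective x := by
    obtain ⟨U, hU, hsub, hzero⟩ := hvan
    intro x hx j k hjk
    by_contra hne
    have hsupp : tsupport ψ ⊆ Uᶜ :=
      closure_minimal (fun y hy hyU => hy (hzero y hyU)) hU.isClosed_compl
    exact hsupp hx (hsub ⟨j, k, hne, hjk⟩)
  have hloc : ∀ a b : ℝ, a < b →
      2 ≤ (∫ y in Set.Icc a b, (N : ℝ) * densityAt ψ (⟨0, by omega⟩ : Fin N) y) →
      (1 / 32) * (Real.pi ^ 2 / 4 + α * (α - 1)) *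
          (∫ y in Set.Icc a b, (N : ℝ) * densityAt ψ (⟨0, by omega⟩ : Fin N) y) ^ 3 / (b - a) ^ 2
        ≤ ∑ j : Fin N, ∫ x, (coordStrip a b j).indicator (particleEnergy α ψ j) x :=
    fun a b hab h2 => local_energy_lower_bound hα hψ hcs hoff hnorm hab h2
      (card_mul_setIntegral_densityAt hψ.continuous hcs hsym _ a b).symm
  refine ⟨fun a b hab h2 => ?_, fun a L hL hsupp => ?_⟩
  · have h := hloc a b hab h2
    simp only [indicator_particleEnergy] at h
    exact h
  · have hdens : ∫ y in Set.Icc a (a + L), (N : ℝ) * densityAt ψ (⟨0, by omega⟩ : Fin N) y = N := by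
      rw [setIntegral_eq_integral_of_forall_compl_eq_zero hsupp, integral_const_mul,
        ← setIntegral_univ, setIntegral_densityAt hψ.continuous hcs _ MeasurableSet.univ,
        Set.preimage_univ, Set.indicator_univ, hnorm, mul_one]
    have h := hloc a (a + L) (by linarith) (by rw [hdens]; exact_mod_cast hN)
    rw [hdens, add_sub_cancel_left] at h
    have hE := integrable_particleEnergy α hψ hcs hoff
    simp only [← sum_particleEnergy]
    rw [integral_finsetSum _ fun j _ => hE j]
    refine h.trans (Finset.sum_le_sum fun j _ => integral_mono
      ((hE j).indicator (isClosed_coordStrip a (a + L) j).measurableSet) (hE j) ?_)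
    exact Set.indicator_le_self' fun x _ => particleEnergy_nonneg hα j x
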